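/- Let T be a closed, densely defined, unbounded linear operator in H; that is, T is a partially defined linear map with domain dom T a dense linear subspace of H, the graph of T is closed in H × H, and there is no constant C ≥ 0 with ‖T x‖ ≤ C‖x‖ for all x ∈ dom T. Then there exists a closed subspace M of H such that M ∩ dom T = {0} and M⊥ ∩ dom T = {0}. -/

import Mathlib

open Filter Topology

theorem aux_C (x y : ℕ → ℂ) (B : ℝ) (hB : ∀ n, ‖x n‖ ≤ B)
    (hy : ∀ m, HasSum (fun n => (((1/2:ℂ))^((m+1)*(n+1))) * x n) (y m))
    (hd : ∀ A : ℕ, Tendsto (fun m : ℕ => ((2:ℝ)^A)^m * ‖y m‖) atTop (𝓝 0)) :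
    ∀ n, x n = 0 := by
  intro n0
  induction n0 using Nat.strong_induction_on with
  | _ n0 ih =>
  have hB0 : 0 ≤ B := (norm_nonneg _).trans (hB 0)
  -- rewrite
  have key : ∀ m, (2:ℂ)^((m+1)*(n0+1)) * y m = ∑' j, ((1/2:ℂ)^(m+1))^j * x (n0+j) := by
    intro m
    have h1 := (hasSum_nat_add_iff' (f := fun n => (((1/2:ℂ))^((m+1)*(n+1))) * x n) n0).2 (hy m)
    rw [Finset.sum_eq_zero (fun i hi => by rw [ih i (Finset.mem_range.1 hi), mul_zero]), sub_zero] at h1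
    have h2 := h1.mul_left ((2:ℂ)^((m+1)*(n0+1)))
    rw [← h2.tsum_eq]
    congr 1; ext j
    have : (2:ℂ)^((m+1)*(n0+1)) * (1/2:ℂ)^((m+1)*(j+n0+1)) = ((1/2:ℂ)^(m+1))^j := by
      rw [show (m+1)*(j+n0+1) = (m+1)*(n0+1) + (m+1)*j by ring, pow_add, ← mul_assoc, ← mul_pow,
        pow_mul (1/2:ℂ)]
      norm_num
    rw [← mul_assoc, this, add_comm j n0]
  have lim1 : Tendsto (fun m => ∑' j, ((1/2:ℂ)^(m+1))^j * x (n0+j)) atTop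
      (𝓝 (∑' j, if j = 0 then x n0 else 0)) := by
    refine tendsto_tsum_of_dominated_convergence (bound := fun j => (1/2:ℝ)^j * B)
      ((summable_geometric_of_lt_one (by norm_num) (by norm_num)).mul_right B) ?_ ?_
    · intro j
      rcases Nat.eq_zero_or_pos j with rfl | hj
      · simp
      · rw [if_neg hj.ne']
        have h0 : Tendsto (fun m : ℕ => (1/2:ℂ)^(m+1)) atTop (𝓝 0) :=
          (tendsto_add_atTop_iff_nat 1).2
            (tendsto_pow_atTop_nhds_zero_of_norm_lt_one (by norm_num))
        have := (h0.pow j).mul_const (x (n0+j))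
        simpa [hj.ne'] using this
    · refine Eventually.of_forall fun m j => ?_
      rw [norm_mul, norm_pow, norm_pow]
      have : (‖(1/2:ℂ)‖^(m+1))^j ≤ (1/2:ℝ)^j := by
        have : ‖(1/2:ℂ)‖ = 1/2 := by norm_num
        rw [this]
        refine pow_le_pow_left₀ (by positivity) ?_ j
        calc (1/2:ℝ)^(m+1) ≤ (1/2:ℝ)^1 := pow_le_pow_of_le_one (by norm_num) (by norm_num) (by omega)
          _ = 1/2 := by norm_num
      exact mul_le_mul this (hB _) (norm_nonneg _) (by positivity)
  rw [tsum_ite_eq] at lim1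
  have lim2 : Tendsto (fun m => (2:ℂ)^((m+1)*(n0+1)) * y m) atTop (𝓝 0) := by
    rw [tendsto_zero_iff_norm_tendsto_zero]
    have := (hd (n0+1)).const_mul ((2:ℝ)^(n0+1))
    rw [mul_zero] at this
    refine this.congr fun m => ?_
    rw [norm_mul, norm_pow, ← mul_assoc]
    congr 1
    rw [← pow_mul, ← pow_add]
    norm_num
    ring
  simp_rw [key] at lim2
  exact tendsto_nhds_unique lim1 lim2

theorem aux_nis {E : Type*} [NormedAddCommGroup E] [InnerProductSpace ℂ E] (x : E) :
    ‖(inner ℂ x x : ℂ)‖ = ‖x‖^2 := by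
  rw [inner_self_eq_norm_sq_to_K]; simp

theorem aux_A {H : Type*} [NormedAddCommGroup H] [InnerProductSpace ℂ H] [CompleteSpace H]
    (T : H →ₗ.[ℂ] H) (hclosed : T.IsClosed)
    (hunbounded : ¬ ∃ C : ℝ, 0 ≤ C ∧ ∀ x : T.domain, ‖T x‖ ≤ C * ‖(x : H)‖) :
    ∀ ε : ℝ, 0 < ε → ∃ h : H, ‖h‖ = 1 ∧
      ∀ x : T.domain, ‖inner ℂ h (x:H)‖ ≤ ε * (‖(x:H)‖ + ‖T x‖) := by
  intro ε hε
  by_contra hcon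
  push Not at hcon
  apply hunbounded
  let Γ : Submodule ℂ (WithLp 2 (H × H)) :=
    T.graph.comap ((WithLp.prodContinuousLinearEquiv 2 ℂ H H : WithLp 2 (H × H) →L[ℂ] H × H) : WithLp 2 (H × H) →ₗ[ℂ] H × H)
  have hΓ : IsClosed (Γ : Set (WithLp 2 (H × H))) :=
    IsClosed.preimage (WithLp.prodContinuousLinearEquiv 2 ℂ H H).continuous hclosed
  have : CompleteSpace Γ := hΓ.completeSpace_coe
  let J : Γ →L[ℂ] H := (ContinuousLinearMap.fst ℂ H H ∘L
    (WithLp.prodContinuousLinearEquiv 2 ℂ H H : WithLp 2 (H × H) →L[ℂ] H × H)) ∘L Γ.subtypeL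
  let Js := ContinuousLinearMap.adjoint J
  have hlow : ∀ h : H, ε * ‖h‖ ≤ ‖Js h‖ := by
    intro h
    by_cases h0 : h = 0
    · simp [h0]
    have hn : 0 < ‖h‖ := norm_pos_iff.2 h0
    obtain ⟨x, hx⟩ := hcon ((‖h‖⁻¹ : ℂ) • h) (by
      rw [norm_smul]; simp [hn.ne'])
    let z : Γ := ⟨WithLp.toLp 2 ((x:H), T x), by
      show ((x:H), T x) ∈ T.graph
      exact T.mem_graph x⟩
    have hz : inner ℂ h (x:H) = inner ℂ (Js h) z := by
      rw [ContinuousLinearMap.adjoint_inner_left]; rfl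
    have hzn : ‖z‖ ≤ ‖(x:H)‖ + ‖T x‖ := by
      have : ‖z‖^2 = ‖(x:H)‖^2 + ‖T x‖^2 := WithLp.prod_norm_sq_eq_of_L2 _
      nlinarith [norm_nonneg (x:H), norm_nonneg (T x), norm_nonneg z]
    rw [inner_smul_left, norm_mul] at hx
    simp only [map_inv₀, Complex.conj_ofReal, norm_inv, Complex.norm_real, norm_norm] at hx
    rw [hz] at hx
    have h3 := norm_inner_le_norm (𝕜 := ℂ) (Js h) z
    have h4 : ‖h‖⁻¹ * ‖inner ℂ (Js h) z‖ ≤ ‖h‖⁻¹ * (‖Js h‖ * (‖(x:H)‖ + ‖T x‖)) := by gcongr; exact h3.trans (by gcongr)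
    have h5 := hx.trans_le h4
    have h6 : 0 ≤ ‖(x:H)‖ + ‖T x‖ := by positivity
    rw [← mul_assoc] at h5
    have h7 := lt_of_mul_lt_mul_right h5 h6
    rw [inv_mul_eq_div, lt_div_iff₀ hn] at h7
    exact h7.le
  have hU : IsUnit (J ∘L Js) := by
    refine ContinuousLinearMap.isUnit_of_forall_le_norm_inner_map (𝕜 := ℂ) _ (c := Real.toNNReal (ε^2))
      (Real.toNNReal_pos.2 (by positivity)) fun x => ?_
    have : inner ℂ ((J ∘L Js) x) x = inner ℂ (Js x) (Js x) := by
      rw [ContinuousLinearMap.adjoint_inner_right]; rfl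
    have h10 : ‖(inner ℂ (Js x) (Js x) : ℂ)‖ = ‖Js x‖^2 := by
      exact aux_nis _
    have h8 := hlow x
    have h9 : (ε * ‖x‖)^2 ≤ ‖Js x‖^2 := pow_le_pow_left₀ (by positivity) h8 2
    rw [this, h10, Real.coe_toNNReal _ (by positivity)]
    nlinarith
  obtain ⟨U, hU⟩ := hU
  refine ⟨‖Js‖ * ‖(↑U⁻¹ : H →L[ℂ] H)‖, by positivity, fun x => ?_⟩
  let h := (↑U⁻¹ : H →L[ℂ] H) x
  have hx : J (Js h) = x := by
    show (J ∘L Js) h = x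
    rw [← hU]
    show ((U : H →L[ℂ] H) * (↑U⁻¹ : H →L[ℂ] H)) x = x
    simp
  have hmem := (Js h).2
  have hmem2 : ((Js h : WithLp 2 (H × H)).fst, (Js h : WithLp 2 (H × H)).snd) ∈ T.graph := hmem
  have hx1 : (Js h : WithLp 2 (H × H)).fst = x := hx
  have hx2 : T x = (Js h : WithLp 2 (H × H)).snd := by
    rw [hx1] at hmem2
    exact (T.mem_graph_snd_inj (T.mem_graph x) hmem2 rfl)
  rw [hx2]
  calc _ ≤ ‖(Js h : WithLp 2 (H × H))‖ := by
        have := WithLp.prod_norm_sq_eq_of_L2 (Js h : WithLp 2 (H × H))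
        nlinarith [norm_nonneg (Js h : WithLp 2 (H × H)), norm_nonneg (Js h : WithLp 2 (H × H)).snd, sq_nonneg ‖(Js h : WithLp 2 (H × H)).fst‖, abs_le_of_sq_le_sq' (a := ‖(Js h : WithLp 2 (H × H)).snd‖) (b := ‖(Js h : WithLp 2 (H × H))‖) (by nlinarith [sq_nonneg ‖(Js h : WithLp 2 (H × H)).fst‖]) (norm_nonneg _)]
    _ ≤ ‖Js‖ * ‖h‖ := Js.le_opNorm h
    _ ≤ ‖Js‖ * (‖(↑U⁻¹ : H →L[ℂ] H)‖ * ‖(x:H)‖) := by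
        gcongr; exact ContinuousLinearMap.le_opNorm _ _
    _ = _ := by ring

theorem aux_B1 {H : Type*} [NormedAddCommGroup H] [InnerProductSpace ℂ H]
    (D : Submodule ℂ H) (hD : Dense (D : Set H)) (N : D → ℝ) (hN : ∀ x : D, ‖(x:H)‖ ≤ N x)
    (hv : ∀ ε : ℝ, 0 < ε → ∃ h : H, ‖h‖ = 1 ∧ ∀ x : D, ‖inner ℂ h (x:H)‖ ≤ ε * N x)
    (F : Submodule ℂ H) [FiniteDimensional ℂ F] (ε : ℝ) (hε : 0 < ε) :
    ∃ g : H, ‖g‖ = 1 ∧ (∀ v ∈ F, inner ℂ v g = 0) ∧ ∀ x : D, ‖inner ℂ g (x:H)‖ ≤ ε * N x := by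
  have hpos : ∀ n : ℕ, 0 < (1 / ((n:ℝ) + 1)) := fun n => by positivity
  choose h hh1 hh2 using fun n : ℕ => hv (1 / ((n:ℝ) + 1)) (hpos n)
  have hlim0 : Tendsto (fun n : ℕ => 1 / ((n:ℝ) + 1)) atTop (𝓝 0) :=
    tendsto_one_div_add_atTop_nhds_zero_nat
  have hweak : ∀ v : H, Tendsto (fun n => inner ℂ v (h n)) atTop (𝓝 0) := by
    intro v
    rw [Metric.tendsto_atTop]
    intro η hη
    obtain ⟨x, hxD, hx⟩ := Metric.mem_closure_iff.1 (hD v) (η/2) (by positivity)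
    have h1 : Tendsto (fun n : ℕ => 1 / ((n:ℝ) + 1) * N ⟨x, hxD⟩) atTop (𝓝 0) := by
      simpa using hlim0.mul_const (N ⟨x, hxD⟩)
    obtain ⟨n0, hn0⟩ := (Metric.tendsto_atTop.1 h1) (η/2) (by positivity)
    refine ⟨n0, fun n hn => ?_⟩
    have h2 := hn0 n hn
    rw [Real.dist_eq, sub_zero] at h2
    have h3 := (hh2 n ⟨x, hxD⟩).trans (le_abs_self _)
    rw [norm_inner_symm] at h3
    have h4 : inner ℂ v (h n) = inner ℂ (v - x) (h n) + inner ℂ x (h n) := by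
      rw [← inner_add_left]; simp
    have h5 := norm_inner_le_norm (𝕜 := ℂ) (v - x) (h n)
    rw [hh1, mul_one] at h5
    rw [dist_eq_norm] at hx
    rw [dist_zero_right, h4]
    calc _ ≤ _ := norm_add_le _ _
      _ < η/2 + η/2 := by
        refine add_lt_add (h5.trans_lt hx) (lt_of_le_of_lt h3 h2)
      _ = η := by ring
  have hP : Tendsto (fun n => F.starProjection (h n)) atTop (𝓝 0) := by
    have b := stdOrthonormalBasis ℂ F
    rw [b.starProjection_eq_sum_rankOne]
    simp only [sum_apply, InnerProductSpace.rankOne_apply]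
    rw [show (0:H) = ∑ i : Fin (Module.finrank ℂ F), (0:ℂ) • (b i : H) by simp]
    exact tendsto_finsetSum _ fun i _ => (hweak _).smul_const _
  set δ := min (1/2) (ε/4) with hδ
  have hδ0 : 0 < δ := by positivity
  have hδ1 : δ ≤ 1/2 := min_le_left _ _
  have hδ2 : δ ≤ ε/4 := min_le_right _ _
  have e1 : ∀ᶠ n in atTop, ‖F.starProjection (h n)‖ < δ := by
    have := hP.norm
    rw [norm_zero] at this
    exact this.eventually_lt_const hδ0
  have e2 := hlim0.eventually_lt_const hδ0
  obtain ⟨n, hn1, hn2⟩ := (e1.and e2).exists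
  set p := F.starProjection (h n) with hp
  have hpF : ∀ v ∈ F, inner ℂ v (h n - p) = 0 := fun v hv =>
    (Submodule.mem_orthogonal _ _).1 (F.sub_starProjection_mem_orthogonal (h n)) v hv
  have hgn : 1/2 ≤ ‖h n - p‖ := by
    have := norm_sub_norm_le (h n) p
    rw [hh1] at this
    linarith
  have hg0 : 0 < ‖h n - p‖ := by linarith
  refine ⟨((‖h n - p‖⁻¹ : ℝ) : ℂ) • (h n - p), ?_, ?_, ?_⟩
  · rw [norm_smul]; simp [hg0.ne']
  · intro v hv
    rw [inner_smul_right, hpF v hv, mul_zero]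
  · intro x
    have hNx : 0 ≤ N x := (norm_nonneg _).trans (hN x)
    rw [inner_smul_left, norm_mul, inner_sub_left]
    have a1 : ‖inner ℂ (h n) (x:H) - inner ℂ p (x:H)‖ ≤ 2 * δ * N x := by
      have b1 := hh2 n x
      have b2 := norm_inner_le_norm (𝕜 := ℂ) p (x:H)
      have b3 : ‖p‖ * ‖(x:H)‖ ≤ δ * N x := mul_le_mul hn1.le (hN x) (norm_nonneg _) hδ0.le
      have b4 : 1 / ((n:ℝ) + 1) * N x ≤ δ * N x := mul_le_mul_of_nonneg_right hn2.le hNx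
      have := norm_sub_le (inner ℂ (h n) (x:H)) (inner ℂ p (x:H))
      linarith
    have a2 : ‖(starRingEnd ℂ) ((‖h n - p‖⁻¹ : ℝ) : ℂ)‖ ≤ 2 := by
      simp only [Complex.conj_ofReal, Complex.norm_real, norm_inv, norm_norm]
      rw [inv_le_comm₀ hg0 (by norm_num)]
      linarith
    calc _ ≤ 2 * (2 * δ * N x) := mul_le_mul a2 a1 (norm_nonneg _) (by norm_num)
      _ ≤ ε * N x := by nlinarith

theorem aux_B2 {H : Type*} [NormedAddCommGroup H] [InnerProductSpace ℂ H]
    (D : Submodule ℂ H) (hD : Dense (D : Set H)) (N : D → ℝ) (hN : ∀ x : D, ‖(x:H)‖ ≤ N x)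
    (hv : ∀ ε : ℝ, 0 < ε → ∃ h : H, ‖h‖ = 1 ∧ ∀ x : D, ‖inner ℂ h (x:H)‖ ≤ ε * N x) :
    ∃ g : ℕ → H, Orthonormal ℂ g ∧ ∀ n, ∀ x : D, ‖inner ℂ (g n) (x:H)‖ ≤ (1/2:ℝ)^(n^2) * N x := by
  obtain ⟨f, hf1, hf2⟩ := exists_seq_of_forall_finset_exists
    (fun p : ℕ × H => ‖p.2‖ = 1 ∧ ∀ x : D, ‖inner ℂ p.2 (x:H)‖ ≤ (1/2:ℝ)^(p.1^2) * N x)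
    (fun p q => p.1 < q.1 ∧ inner ℂ p.2 q.2 = 0) (by
      intro s _
      classical
      let F : Submodule ℂ H := Submodule.span ℂ ((s.image Prod.snd : Finset H) : Set H)
      let m := s.sup Prod.fst + 1
      obtain ⟨g, h1, h2, h3⟩ := aux_B1 D hD N hN hv F ((1/2:ℝ)^(m^2)) (by positivity)
      refine ⟨(m, g), ⟨h1, h3⟩, fun p hp => ⟨?_, ?_⟩⟩
      · exact Nat.lt_succ_of_le (Finset.le_sup (f := Prod.fst) hp)
      · exact h2 _ (Submodule.subset_span (Finset.mem_coe.2 (Finset.mem_image_of_mem _ hp))))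
  have hmono : StrictMono fun n => (f n).1 := fun a b hab => (hf2 a b hab).1
  refine ⟨fun n => (f n).2, ⟨fun n => (hf1 n).1, ?_⟩, fun n x => ?_⟩
  · intro i j hij
    rcases lt_or_gt_of_ne hij with h | h
    · exact (hf2 i j h).2
    · exact inner_eq_zero_symm.1 (hf2 j i h).2
  · refine ((hf1 n).2 x).trans ?_
    have hNx : 0 ≤ N x := (norm_nonneg _).trans (hN x)
    refine mul_le_mul_of_nonneg_right ?_ hNx
    exact pow_le_pow_of_le_one (by norm_num) (by norm_num)
      (Nat.pow_le_pow_left (hmono.le_apply) 2)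

theorem aux_E {H : Type*} [NormedAddCommGroup H] [InnerProductSpace ℂ H] [CompleteSpace H]
    [TopologicalSpace.SeparableSpace H] (g : ℕ → H) (hg : Orthonormal ℂ g) :
    ∃ e : ℕ × ℕ × Bool → H, Orthonormal ℂ e ∧ (∀ x, (∀ j, inner ℂ (e j) x = 0) → x = 0) ∧
      ∀ k n s, ∃ i, n + 1 ≤ i ∧ e (k, n + 1, s) = g i := by
  classical
  have hginj : Function.Injective g := hg.linearIndependent.injective
  obtain ⟨w, b, hw, hb⟩ := hg.toSubtypeRange.exists_hilbertBasis_extension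
  have hwo : Orthonormal ℂ ((↑) : w → H) := hb ▸ b.orthonormal
  have hwc : w.Countable := by
    refine Set.PairwiseDisjoint.countable_of_isOpen (s := fun v : H => Metric.ball v (1/2)) ?_
      (fun v _ => Metric.isOpen_ball) (fun v _ => ⟨v, Metric.mem_ball_self (by norm_num)⟩)
    intro v hv v' hv' hne
    refine Metric.ball_disjoint_ball ?_
    have h0 : inner ℂ v v' = 0 :=
      hwo.2 (i := ⟨v, hv⟩) (j := ⟨v', hv'⟩) (fun h => hne (congrArg Subtype.val h))
    have h1 : ‖v‖ = 1 := hwo.1 ⟨v, hv⟩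
    have h2 : ‖v'‖ = 1 := hwo.1 ⟨v', hv'⟩
    have h3 := norm_sub_sq (𝕜 := ℂ) v v'
    rw [h0, h1, h2] at h3
    simp at h3
    rw [dist_eq_norm]
    nlinarith [norm_nonneg (v - v')]
  let code : ℕ × ℕ × Bool → ℕ := fun j => 2 * Nat.pair j.1 (Nat.pair j.2.1 j.2.2.toNat) + 1
  have hcinj : Function.Injective code := by
    rintro ⟨k, n, s⟩ ⟨k', n', s'⟩ h
    have h' : Nat.pair k (Nat.pair n s.toNat) = Nat.pair k' (Nat.pair n' s'.toNat) := by
      simp only [code] at h; omega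
    rw [Nat.pair_eq_pair, Nat.pair_eq_pair] at h'
    obtain ⟨h1, h2, h3⟩ := h'
    subst h1 h2
    cases s <;> cases s' <;> simp_all
  let S : Set (ℕ × ℕ × Bool) := {j | ¬ (j.2.1 = 0 ∧ j.2.2 = false)}
  let F : Set H := w \ ((fun j => g (code j)) '' S)
  have hFi : F.Infinite := by
    refine Set.infinite_of_injective_forall_mem (f := fun n : ℕ => g (2 * n)) ?_ ?_
    · intro a b h
      have := hginj h
      omega
    · intro n
      refine ⟨hw ⟨_, rfl⟩, ?_⟩
      rintro ⟨j, _, hj⟩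
      have := hginj hj
      simp only [code] at this
      omega
  have hFc : F.Countable := hwc.mono Set.sdiff_subset
  have : Infinite F := hFi.to_subtype
  have : Countable F := hFc.to_subtype
  obtain ⟨φ⟩ : Nonempty (ℕ ≃ F) := by
    have := (nonempty_denumerable F)
    exact this.map fun d => (@Denumerable.eqv F d).symm
  let e : ℕ × ℕ × Bool → H := fun j => if j ∈ S then g (code j) else φ j.1
  have hew : ∀ j, e j ∈ w := by
    intro j
    by_cases h : j ∈ S
    · simp only [e, if_pos h]; exact hw ⟨_, rfl⟩
    · simp only [e, if_neg h]; exact (φ j.1).2.1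
  have heinj : Function.Injective e := by
    intro i j h
    by_cases hi : i ∈ S <;> by_cases hj : j ∈ S
    · simp only [e, if_pos hi, if_pos hj] at h
      exact hcinj (hginj h)
    · simp only [e, if_pos hi, if_neg hj] at h
      exact ((φ j.1).2.2 ⟨i, hi, h⟩).elim
    · simp only [e, if_neg hi, if_pos hj] at h
      exact ((φ i.1).2.2 ⟨j, hj, h.symm⟩).elim
    · simp only [e, if_neg hi, if_neg hj] at h
      have := φ.injective (Subtype.ext h)
      simp only [S, Set.mem_ofPred_eq, not_not] at hi hj
      exact Prod.ext this (Prod.ext (hi.1.trans hj.1.symm) (hi.2.trans hj.2.symm))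
  refine ⟨e, ?_, ?_, ?_⟩
  · exact hwo.comp (fun j => (⟨e j, hew j⟩ : w)) (fun i j h => heinj (congrArg Subtype.val h))
  · intro x hx
    have hall : ∀ v : w, inner ℂ (b v) x = 0 := by
      intro v
      rw [hb]
      by_cases h : (v:H) ∈ ((fun j => g (code j)) '' S)
      · obtain ⟨j, hj, hjv⟩ := h
        have := hx j
        simp only [e, if_pos hj] at this
        rw [← hjv]; exact this
      · have := hx (φ.symm ⟨v, v.2, h⟩, 0, false)
        have hS : (φ.symm ⟨v, v.2, h⟩, 0, false) ∉ S := by simp [S]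
        simpa only [e, if_neg hS, Equiv.apply_symm_apply] using this
    have h1 := b.hasSum_repr x
    simp only [b.repr_apply_apply, hall, zero_smul] at h1
    exact h1.unique hasSum_zero
  · intro k n s
    refine ⟨code (k, n+1, s), ?_, ?_⟩
    · have h1 := Nat.left_le_pair (n+1) s.toNat
      have h2 := Nat.right_le_pair k (Nat.pair (n+1) s.toNat)
      simp only [code]
      omega
    · have hS : (k, n+1, s) ∈ S := by simp [S]
      simp only [e, if_pos hS]

theorem aux_c_le (m n : ℕ) : ‖((1/2:ℂ))^((m+1)*(n+1))‖ ≤ (1/2:ℝ)^n := by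
  rw [norm_pow]
  have : ‖(1/2:ℂ)‖ = 1/2 := by norm_num
  rw [this]
  exact pow_le_pow_of_le_one (by norm_num) (by norm_num) (by nlinarith)

theorem aux_sum {H : Type*} [NormedAddCommGroup H] [InnerProductSpace ℂ H] [CompleteSpace H]
    (a : ℕ → H) (ha : ∀ n, ‖a n‖ = 1) (m : ℕ) :
    ∃ s : H, HasSum (fun n => ((1/2:ℂ))^((m+1)*(n+1)) • a n) s ∧
      ∀ x, HasSum (fun n => ((1/2:ℂ))^((m+1)*(n+1)) * inner ℂ (a n) x) (inner ℂ s x) := by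
  have hs : Summable (fun n => ((1/2:ℂ))^((m+1)*(n+1)) • a n) := by
    refine Summable.of_norm_bounded (g := fun n => (1/2:ℝ)^n)
      (summable_geometric_of_lt_one (by norm_num) (by norm_num)) fun n => ?_
    rw [norm_smul, ha, mul_one]
    exact aux_c_le m n
  obtain ⟨s, hs⟩ := hs
  refine ⟨s, hs, fun x => ?_⟩
  have h1 := hs.mapL (innerSL ℂ x)
  have h2 := h1.star
  simp only [innerSL_apply_apply, inner_smul_right, star_mul', RCLike.star_def, inner_conj_symm,
    map_pow] at h2
  have h3 : (starRingEnd ℂ) (1/2:ℂ) = 1/2 := by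
    rw [map_div₀, map_one, map_ofNat]
  simpa only [h3] using h2

theorem aux_one {H : Type*} [NormedAddCommGroup H] [InnerProductSpace ℂ H]
    (e : ℕ × ℕ × Bool → H) (he : Orthonormal ℂ e) (k l n m : ℕ) (s t : Bool) :
    HasSum (fun i => (1/2:ℂ)^((n+1)*(i+1)) * inner ℂ (e (k, i, t)) (e (l, m, s)))
      (if l = k ∧ s = t then (1/2:ℂ)^((n+1)*(m+1)) else 0) := by
  by_cases h : l = k ∧ s = t
  · obtain ⟨rfl, rfl⟩ := h
    rw [if_pos ⟨rfl, rfl⟩]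
    have h1 : inner ℂ (e (l, m, s)) (e (l, m, s)) = 1 := by
      rw [inner_self_eq_norm_sq_to_K, he.1]; simp
    have := hasSum_single (f := fun i => (1/2:ℂ)^((n+1)*(i+1)) * inner ℂ (e (l, i, s)) (e (l, m, s)))
      m (fun i hi => by
        have h2 : inner ℂ (e (l, i, s)) (e (l, m, s)) = 0 := he.2 (by simpa using hi)
        simp only [h2, mul_zero])
    simpa only [h1, mul_one] using this
  · rw [if_neg h]
    have h2 : ∀ i, inner ℂ (e (k, i, t)) (e (l, m, s)) = 0 := fun i => he.2 (by
      intro h3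
      simp only [Prod.mk.injEq] at h3
      exact h ⟨h3.1.symm, h3.2.2.symm⟩)
    simp only [h2, mul_zero]
    exact hasSum_zero

theorem aux_D {H : Type*} [NormedAddCommGroup H] [InnerProductSpace ℂ H] [CompleteSpace H]
    (D : Submodule ℂ H) (e : ℕ × ℕ × Bool → H) (he : Orthonormal ℂ e)
    (htot : ∀ x, (∀ j, inner ℂ (e j) x = 0) → x = 0)
    (hdec : ∀ x ∈ D, ∀ k s, ∀ A : ℕ,
      Tendsto (fun m : ℕ => ((2:ℝ)^A)^m * ‖inner ℂ (e (k, m, s)) x‖) atTop (𝓝 0)) :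
    ∃ M : Submodule ℂ H, IsClosed (M : Set H) ∧ M ⊓ D = ⊥ ∧ Mᗮ ⊓ D = ⊥ := by
  have hb : ∀ x j, ‖inner ℂ (e j) x‖ ≤ ‖x‖ := fun x j => by
    have := norm_inner_le_norm (𝕜 := ℂ) (e j) x
    rwa [he.1 j, one_mul] at this
  choose p hp1 hp2 using fun k m => aux_sum (fun n => e (k, n, false)) (fun n => he.1 _) m
  choose q hq1 hq2 using fun k m => aux_sum (fun n => e (k, n, true)) (fun n => he.1 _) m
  let w : ℕ × ℕ → H := fun j => e (j.1, j.2, true) - p j.1 j.2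
  let M : Submodule ℂ H := (Submodule.span ℂ (Set.range w))ᗮ
  have hMmem : ∀ x, x ∈ M ↔ ∀ k m, inner ℂ (e (k, m, true)) x = inner ℂ (p k m) x := by
    intro x
    constructor
    · intro hx k m
      have := (Submodule.mem_orthogonal _ _).1 hx (w (k, m)) (Submodule.subset_span ⟨_, rfl⟩)
      simpa only [w, inner_sub_left, sub_eq_zero] using this
    · intro hx
      rw [Submodule.mem_orthogonal]
      intro u hu
      induction hu using Submodule.span_induction with
      | mem u hu =>
        obtain ⟨⟨k, m⟩, rfl⟩ := hu
        simp only [w, inner_sub_left, sub_eq_zero]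
        exact hx k m
      | zero => simp
      | add u v _ _ h1 h2 => rw [inner_add_left, h1, h2, add_zero]
      | smul c u _ h1 => rw [inner_smul_left, h1, mul_zero]
  have hu : ∀ k n, e (k, n, false) + q k n ∈ M := by
    intro k n
    rw [hMmem]
    intro l m
    have hqe : ∀ j, inner ℂ (q k n) (e j) = if j.1 = k ∧ j.2.2 = true then (1/2:ℂ)^((n+1)*(j.2.1+1)) else 0 := by
      rintro ⟨l, m, s⟩
      exact (hq2 k n (e (l, m, s))).unique (aux_one e he k l n m s true)
    have hpe : ∀ j, inner ℂ (p l m) (e j) = if j.1 = l ∧ j.2.2 = false then (1/2:ℂ)^((m+1)*(j.2.1+1)) else 0 := by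
      rintro ⟨l', m', s⟩
      exact (hp2 l m (e (l', m', s))).unique (aux_one e he l l' m m' s false)
    have hpq : inner ℂ (p l m) (q k n) = 0 := by
      refine (hp2 l m (q k n)).unique ?_
      have : ∀ i, inner ℂ (e (l, i, false)) (q k n) = 0 := fun i => by
        rw [inner_eq_zero_symm, hqe]; simp
      simp only [this, mul_zero]
      exact hasSum_zero
    have h0 : inner ℂ (e (l, m, true)) (e (k, n, false)) = 0 := he.2 (by simp)
    have h3 : (starRingEnd ℂ) (1/2:ℂ) = 1/2 := by rw [map_div₀, map_one, map_ofNat]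
    rw [inner_add_right, inner_add_right, hpq, hpe, h0, ← inner_conj_symm, hqe]
    by_cases h : l = k
    · subst h
      rw [if_pos ⟨rfl, rfl⟩, if_pos ⟨rfl, rfl⟩, map_pow, h3, mul_comm (n+1), zero_add, add_zero]
    · rw [if_neg (fun h4 => h h4.1), if_neg (fun h4 => h h4.1.symm)]
      simp
  refine ⟨M, Submodule.isClosed_orthogonal _, ?_, ?_⟩
  · rw [Submodule.eq_bot_iff]
    rintro x ⟨hxM, hxD⟩
    have hxM' := (hMmem x).1 hxM
    have hA : ∀ k n, inner ℂ (e (k, n, false)) x = 0 := fun k =>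
      aux_C (fun n => inner ℂ (e (k, n, false)) x) (fun m => inner ℂ (e (k, m, true)) x) ‖x‖
        (fun n => hb _ _) (fun m => by rw [hxM' k m]; exact hp2 k m x) (hdec x hxD k true)
    have hB : ∀ k m, inner ℂ (e (k, m, true)) x = 0 := fun k m => by
      rw [hxM' k m]
      refine (hp2 k m x).unique ?_
      simp only [hA, mul_zero]
      exact hasSum_zero
    refine htot x ?_
    rintro ⟨k, n, s⟩
    cases s
    · exact hA k n
    · exact hB k n
  · rw [Submodule.eq_bot_iff]
    rintro x ⟨hxM, hxD⟩
    have hxM' : ∀ k n, inner ℂ (e (k, n, false)) x = - inner ℂ (q k n) x := fun k n => by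
      have := (Submodule.mem_orthogonal _ _).1 hxM _ (hu k n)
      rw [inner_add_left] at this
      exact eq_neg_of_add_eq_zero_left this
    have hB : ∀ k m, inner ℂ (e (k, m, true)) x = 0 := fun k =>
      aux_C (fun n => inner ℂ (e (k, n, true)) x) (fun m => - inner ℂ (e (k, m, false)) x) ‖x‖
        (fun n => hb _ _) (fun m => by rw [hxM' k m, neg_neg]; exact hq2 k m x)
        (by simpa only [norm_neg] using hdec x hxD k false)
    have hA : ∀ k m, inner ℂ (e (k, m, false)) x = 0 := fun k m => by
      rw [hxM' k m, neg_eq_zero]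
      refine (hq2 k m x).unique ?_
      simp only [hB, mul_zero]
      exact hasSum_zero
    refine htot x ?_
    rintro ⟨k, n, s⟩
    cases s
    · exact hA k n
    · exact hB k n

/-- Theorem 3.17 (1) (Schmüdgen's theorem, revised): for a closed, densely defined,
unbounded linear operator `T` in `H` there exists a closed subspace `M` of `H` with
`M ∩ dom T = {0}` and `M⊥ ∩ dom T = {0}`. -/
theorem stmt_16
    {H : Type*} [NormedAddCommGroup H] [InnerProductSpace ℂ H] [CompleteSpace H]
    [TopologicalSpace.SeparableSpace H] (hinf : ¬ FiniteDimensional ℂ H)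
    (T : H →ₗ.[ℂ] H)
    (hdense : Dense (T.domain : Set H))
    (hclosed : T.IsClosed)
    (hunbounded : ¬ ∃ C : ℝ, 0 ≤ C ∧ ∀ x : T.domain, ‖T x‖ ≤ C * ‖(x : H)‖) :
    ∃ M : Submodule ℂ H, IsClosed (M : Set H) ∧
      M ⊓ T.domain = ⊥ ∧ Mᗮ ⊓ T.domain = ⊥ := by
  obtain ⟨g, hg, hgN⟩ := aux_B2 T.domain hdense (fun x => ‖(x:H)‖ + ‖T x‖)
    (fun x => le_add_of_nonneg_right (norm_nonneg _)) (aux_A T hclosed hunbounded)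
  obtain ⟨e, he, htot, heg⟩ := aux_E g hg
  refine aux_D T.domain e he htot ?_
  intro x hx k s A
  set R := ‖x‖ + ‖T ⟨x, hx⟩‖ with hR
  have hR0 : 0 ≤ R := by positivity
  have hlim : Tendsto (fun m : ℕ => (1/2:ℝ)^m * R) atTop (𝓝 0) := by
    simpa using (tendsto_pow_atTop_nhds_zero_of_lt_one (r := (1/2:ℝ)) (by norm_num)
      (by norm_num)).mul_const R
  refine squeeze_zero' (Eventually.of_forall fun m => by positivity) ?_ hlim
  filter_upwards [eventually_ge_atTop (A + 1)] with m hm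
  obtain ⟨n, rfl⟩ : ∃ n, m = n + 1 := ⟨m - 1, by omega⟩
  obtain ⟨i, hi, hei⟩ := heg k n s
  rw [hei]
  have h1 : ‖inner ℂ (g i) x‖ ≤ (1/2:ℝ)^(i^2) * R := hgN i ⟨x, hx⟩
  have h2 : (1/2:ℝ)^(i^2) ≤ (1/2:ℝ)^(A*(n+1) + (n+1)) :=
    pow_le_pow_of_le_one (by norm_num) (by norm_num) (by nlinarith)
  calc ((2:ℝ)^A)^(n+1) * ‖inner ℂ (g i) x‖
      ≤ ((2:ℝ)^A)^(n+1) * ((1/2:ℝ)^(A*(n+1) + (n+1)) * R) := by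
        gcongr
        exact h1.trans (mul_le_mul_of_nonneg_right h2 hR0)
    _ = (1/2:ℝ)^(n+1) * R := by
        rw [pow_add (1/2:ℝ), ← pow_mul, ← mul_assoc, ← mul_assoc, ← mul_pow]
        norm_num
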